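/- Let N ≥ 1 and k ≥ 1 be integers, let a, b be nonnegative integers, and let e^k(z₁,z₂) := Π_{j=0}^{k} (j·z₁ + (k−j)·z₂) ∈ ℂ[z₁,z₂]. Then the coefficient of z₁^{N−1}·z₂^{N−1} in the polynomial z₁^a·e^k(z₁,z₂)·z₂^b − z₁^{a+b}·e^k(z₁,z₂) + (1/2)·e^k(z₁,z₂)·(z₁^a − z₂^a)·(z₁^b − z₂^b) is zero. -/

import Mathlib

open MvPolynomial

/-- `e^k(z₁,z₂) = ∏_{j=0}^{k} (j z₁ + (k-j) z₂)` as a polynomial in `ℂ[z₁,z₂]`. -/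
noncomputable def ekPoly (k : ℕ) : MvPolynomial (Fin 2) ℂ :=
  ∏ j ∈ Finset.range (k + 1), (C (j : ℂ) * X 0 + C ((k : ℂ) - (j : ℂ)) * X 1)

theorem ekPoly_swap (k : ℕ) : rename (Equiv.swap (0 : Fin 2) 1) (ekPoly k) = ekPoly k := by
  unfold ekPoly
  rw [map_prod, ← Finset.prod_range_reflect]
  apply Finset.prod_congr rfl
  intro j hj
  have hj' : j ≤ k := by
    have := Finset.mem_range.mp hj
    omega
  have e : k + 1 - 1 - j = k - j := by omega
  rw [e]
  simp only [map_add, map_mul, rename_C, rename_X, Equiv.swap_apply_left, Equiv.swap_apply_right,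
    Nat.cast_sub hj', sub_sub_cancel]
  ring

theorem stmt_14 (N k : ℕ) (hN : 1 ≤ N) (hk : 1 ≤ k) (a b : ℕ) :
    (X 0 ^ a * ekPoly k * X 1 ^ b - X 0 ^ (a + b) * ekPoly k +
        C (1 / 2 : ℂ) * ekPoly k * (X 0 ^ a - X 1 ^ a) * (X 0 ^ b - X 1 ^ b)).coeff
      (Finsupp.single 0 (N - 1) + Finsupp.single 1 (N - 1)) = 0 := by
  have half : (C (1 / 2 : ℂ) : MvPolynomial (Fin 2) ℂ) * 2 = 1 := by
    have : (2 : MvPolynomial (Fin 2) ℂ) = C 2 := (map_ofNat C 2).symm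
    rw [this, ← C_mul]
    norm_num
  set P : MvPolynomial (Fin 2) ℂ := X 0 ^ a * ekPoly k * X 1 ^ b - X 0 ^ (a + b) * ekPoly k +
        C (1 / 2 : ℂ) * ekPoly k * (X 0 ^ a - X 1 ^ a) * (X 0 ^ b - X 1 ^ b) with hP
  have hs : rename (Equiv.swap (0 : Fin 2) 1) P = -P := by
    rw [hP]
    simp only [map_add, map_sub, map_mul, map_pow, rename_C, rename_X, Equiv.swap_apply_left,
      Equiv.swap_apply_right, ekPoly_swap]
    linear_combination (ekPoly k * (X 0 ^ a - X 1 ^ a) * (X 0 ^ b - X 1 ^ b)) * half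
  have h := coeff_rename_mapDomain (Equiv.swap (0 : Fin 2) 1) (Equiv.injective _) P
    (Finsupp.single 0 (N - 1) + Finsupp.single 1 (N - 1))
  rw [Finsupp.mapDomain_add, Finsupp.mapDomain_single, Finsupp.mapDomain_single,
    Equiv.swap_apply_left, Equiv.swap_apply_right, add_comm, hs, coeff_neg] at h
  exact self_eq_neg.mp h.symm
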